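/- Let H and K be groups and φ : K → Aut(H) an action of K on H by automorphisms. Let C be the subgroup of H^ab generated by all elements [φ(k)(h)]·[h]⁻¹ with k ∈ K and h ∈ H, and let (H^ab)_K := H^ab/C denote the group of coinvariants. Then the abelianization of the semidirect product H ⋊_φ K is isomorphic to the direct product (H^ab)_K × K^ab. -/

import Mathlib

namespace SemidirectProduct

variable {H K : Type*} [Group H] [Group K] (φ : K →* MulAut H)

/-- The subgroup of `H^ab` generated by the elements `[φ k h] * [h]⁻¹`. -/
abbrev coinvariantsSubgroup : Subgroup (Abelianization H) :=
  Subgroup.closure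
    {x : Abelianization H | ∃ (k : K) (h : H),
      x = Abelianization.of (φ k h) * (Abelianization.of h)⁻¹}

theorem mk_of_apply_eq_mk_of (k : K) (h : H) :
    (QuotientGroup.mk (Abelianization.of (φ k h)) :
      Abelianization H ⧸ coinvariantsSubgroup φ) =
      QuotientGroup.mk (Abelianization.of h) := by
  rw [eq_comm, QuotientGroup.eq, mul_comm]
  exact Subgroup.subset_closure ⟨k, h, rfl⟩

/-- The map `(h, k) ↦ ([h], [k])` from `H ⋊[φ] K` to `(H^ab)_K × K^ab`. -/
def toCoinvariantsProd :
    H ⋊[φ] K →* (Abelianization H ⧸ coinvariantsSubgroup φ) × Abelianization K :=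
  lift
    ((MonoidHom.inl _ _).comp
      ((QuotientGroup.mk' (coinvariantsSubgroup φ)).comp Abelianization.of))
    ((MonoidHom.inr _ _).comp Abelianization.of)
    (fun k ↦ by
      ext h
      · simpa using mk_of_apply_eq_mk_of φ k h
      · simp)

theorem coinvariantsSubgroup_le_ker_map_inl :
    coinvariantsSubgroup φ ≤ (Abelianization.map (inl : H →* H ⋊[φ] K)).ker := by
  rw [Subgroup.closure_le]
  rintro _ ⟨k, h, rfl⟩
  simp [MonoidHom.mem_ker, inl_aut]

/-- The map `([h], [k]) ↦ [(h, k)]` from `(H^ab)_K × K^ab` to `(H ⋊[φ] K)^ab`. -/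
def ofCoinvariantsProd :
    (Abelianization H ⧸ coinvariantsSubgroup φ) × Abelianization K →*
      Abelianization (H ⋊[φ] K) :=
  (QuotientGroup.lift (coinvariantsSubgroup φ) (Abelianization.map inl)
    (coinvariantsSubgroup_le_ker_map_inl φ)).coprod (Abelianization.map inr)

theorem ofCoinvariantsProd_comp_lift_toCoinvariantsProd :
    (ofCoinvariantsProd φ).comp (Abelianization.lift (toCoinvariantsProd φ)) =
      MonoidHom.id _ := by
  apply Abelianization.hom_ext
  apply hom_ext
  · ext h
    simp [toCoinvariantsProd, ofCoinvariantsProd]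
  · ext k
    simp [toCoinvariantsProd, ofCoinvariantsProd]

theorem lift_toCoinvariantsProd_comp_ofCoinvariantsProd :
    (Abelianization.lift (toCoinvariantsProd φ)).comp (ofCoinvariantsProd φ) =
      MonoidHom.id _ := by
  apply MonoidHom.ext
  rintro ⟨x, y⟩
  obtain ⟨x, rfl⟩ := QuotientGroup.mk_surjective x
  obtain ⟨h, rfl⟩ := QuotientGroup.mk_surjective x
  obtain ⟨k, rfl⟩ := QuotientGroup.mk_surjective y
  change Abelianization.lift (toCoinvariantsProd φ)
    (Abelianization.of (inl h) * Abelianization.of (inr k)) = _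
  rw [map_mul, Abelianization.lift_apply_of, Abelianization.lift_apply_of]
  simp [toCoinvariantsProd]
  rfl

end SemidirectProduct

/-- Let `H` and `K` be groups and `φ : K → Aut H` an action of `K` on `H` by
automorphisms.  Let `C` be the subgroup of `H^ab` generated by the elements
`[φ k h] * [h]⁻¹` for `k ∈ K`, `h ∈ H`, and let `(H^ab)_K = H^ab ⧸ C` be the coinvariants.
Then the abelianization of the semidirect product `H ⋊[φ] K` is isomorphic to
`(H^ab)_K × K^ab`. -/
theorem abelianization_semidirectProduct {H K : Type*} [Group H] [Group K]
    (φ : K →* MulAut H) :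
    Nonempty (Abelianization (H ⋊[φ] K) ≃*
      ((Abelianization H ⧸ Subgroup.closure
          {x : Abelianization H | ∃ (k : K) (h : H),
            x = Abelianization.of (φ k h) * (Abelianization.of h)⁻¹}) ×
        Abelianization K)) := by
  exact ⟨MonoidHom.toMulEquiv
    (Abelianization.lift (SemidirectProduct.toCoinvariantsProd φ))
    (SemidirectProduct.ofCoinvariantsProd φ)
    (SemidirectProduct.ofCoinvariantsProd_comp_lift_toCoinvariantsProd φ)
    (SemidirectProduct.lift_toCoinvariantsProd_comp_ofCoinvariantsProd φ)⟩
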